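/- Let n ≥ 3. Then I_{−1} = M̃_0 ∪ I_0; explicitly, for all u, v ∈ C_n, either u (x_n x_{n−1}⋯x_1) v ∈ I_0, or u (x_n x_{n−1}⋯x_1) v = [a] (x_n x_{n−1}⋯x_1)^k [b] in C_n for some suffix a of the word x_{n−1} x_{n−2}⋯x_1, some prefix b of the word x_n x_{n−1}⋯x_2, and some k ≥ 1. -/

import Mathlib

namespace HK

/-- The generator `x_k` of the free monoid on `ZMod n` (indices taken mod `n`,
so `x_n` is the letter `0`). -/
def fx (n k : ℕ) : FreeMonoid (ZMod n) := FreeMonoid.of (k : ZMod n)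

/-- The ascending word `x_a x_{a+1} ⋯ x_b` (empty if `b < a`). -/
def asc (n a b : ℕ) : FreeMonoid (ZMod n) :=
  FreeMonoid.ofList ((List.range' a (b + 1 - a)).map fun k => (k : ZMod n))

/-- The descending word `x_a x_{a-1} ⋯ x_b` (empty if `a < b`). -/
def desc (n a b : ℕ) : FreeMonoid (ZMod n) :=
  FreeMonoid.ofList (((List.range' b (a + 1 - b)).map fun k => (k : ZMod n)).reverse)

/-- `x_a ⋯ x_b`: ascending if `a ≤ b`, descending otherwise. -/
def seg (n a b : ℕ) : FreeMonoid (ZMod n) := if a ≤ b then asc n a b else desc n a b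

/-- The word `q_i = x_1 ⋯ x_i x_{n-1} x_{n-2} ⋯ x_{i+1}`. -/
def qw (n i : ℕ) : FreeMonoid (ZMod n) := asc n 1 i * desc n (n - 1) (i + 1)

/-- `|u|_c`: the number of occurrences of the letter `c` in the word `u`. -/
def cnt (n : ℕ) (u : FreeMonoid (ZMod n)) (c : ZMod n) : ℕ :=
  (FreeMonoid.toList u).count c

/-- `w` is a factor of `v`. -/
def IsFactor {α : Type*} (w v : FreeMonoid α) : Prop := ∃ v₁ v₂, v = v₁ * w * v₂

/-- A word is reduced if it contains no factor of the forms (1)–(5). -/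
def Reduced (n : ℕ) (w : FreeMonoid (ZMod n)) : Prop :=
  (∀ i : ℕ, 1 ≤ i → i ≤ n → ¬ IsFactor (fx n i * fx n i) w) ∧
  (∀ i j : ℕ, 1 ≤ i → j ≤ n → 1 < j - i → j - i < n - 1 →
      ¬ IsFactor (fx n j * fx n i) w) ∧
  (∀ i j : ℕ, 1 ≤ i → i + 1 < j → j < n - 1 →
      ¬ IsFactor (fx n n * asc n 1 i * fx n j) w) ∧
  (∀ i : ℕ, ∀ u : FreeMonoid (ZMod n), 1 ≤ i → i ≤ n → u ≠ 1 →
      cnt n u (i : ZMod n) = 0 → cnt n u ((i : ZMod n) - 1) = 0 →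
      ¬ IsFactor (fx n i * u * fx n i) w) ∧
  (∀ i : ℕ, ∀ u : FreeMonoid (ZMod n), 1 ≤ i → i ≤ n → u ≠ 1 →
      cnt n u (i : ZMod n) = 0 → cnt n u ((i : ZMod n) + 1) = 0 →
      ¬ IsFactor (fx n i * u * fx n i) w)

/-- Membership in the set `A_i`. -/
def InA (n i : ℕ) (a : FreeMonoid (ZMod n)) : Prop :=
  ∃ (s : ℕ) (k : ℕ → ℕ),
    s ≤ i + 1 ∧
    (1 ≤ s → 1 ≤ k s ∧ k s ≤ s) ∧
    (∀ t, s + 1 ≤ t → t ≤ i + 1 → t < k t ∧ k t ≤ n - 1) ∧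
    (∀ t, s + 1 ≤ t → t + 1 ≤ i + 1 → k t < k (t + 1)) ∧
    ∃ p : FreeMonoid (ZMod n),
      p * a = (if s = 0 then 1 else seg n (k s) s) *
        ((List.range' (s + 1) (i + 1 - s)).map fun t => seg n (k t) t).prod

/-- Membership in the set `B_i`. -/
def InB (n i : ℕ) (b : FreeMonoid (ZMod n)) : Prop :=
  ∃ (r : ℕ) (I J : ℕ → ℕ),
    (∀ t, 1 ≤ t → t ≤ r → 1 ≤ I t ∧ I t < i + 1) ∧
    (∀ t, 1 ≤ t → t + 1 ≤ r → I (t + 1) < I t) ∧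
    i + 1 < J 1 ∧
    (∀ t, 1 ≤ t → t + 1 ≤ r + 1 → J t < J (t + 1)) ∧
    J (r + 1) ≤ n ∧
    ∃ p : FreeMonoid (ZMod n),
      b * p = ((List.range' 1 r).map fun t =>
          fx n n * asc n 1 (I t) * desc n (n - 1) (J t)).prod *
        (fx n n * desc n (n - 1) (J (r + 1)))

/-- The defining relations of the Hecke–Kiselman monoid of the oriented cycle. -/
def cnRel (n : ℕ) : FreeMonoid (ZMod n) → FreeMonoid (ZMod n) → Prop := fun w v =>
  (∃ a : ZMod n, w = FreeMonoid.of a * FreeMonoid.of a ∧ v = FreeMonoid.of a) ∨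
  (∃ a b : ZMod n, b ≠ a + 1 ∧ a ≠ b + 1 ∧
    w = FreeMonoid.of a * FreeMonoid.of b ∧ v = FreeMonoid.of b * FreeMonoid.of a) ∨
  (∃ a : ZMod n,
    (w = FreeMonoid.of a * FreeMonoid.of (a + 1) * FreeMonoid.of a ∨
     w = FreeMonoid.of (a + 1) * FreeMonoid.of a * FreeMonoid.of (a + 1)) ∧
    v = FreeMonoid.of a * FreeMonoid.of (a + 1))

/-- The Hecke–Kiselman monoid `C_n` of the oriented cycle of length `n`. -/
abbrev Cn (n : ℕ) := (conGen (cnRel n)).Quotient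

/-- The canonical projection `F → C_n`. -/
def pr (n : ℕ) : FreeMonoid (ZMod n) →* Cn n := (conGen (cnRel n)).mk'

/-- The ideal `I_i` of `C_n`. -/
def Iset (n i : ℕ) : Set (Cn n) :=
  {w | ¬ ∃ (u v : Cn n) (k : ℕ), 1 ≤ k ∧ u * w * v = (pr n (fx n n * qw n i)) ^ k}



def ff (n : ℕ) (a : ZMod n) : Function.End (ZMod n) := fun p => if p = a then p - 1 else p

lemma ff_apply (n : ℕ) (a p : ZMod n) : ff n a p = if p = a then p - 1 else p := rfl

lemma one_ne (n : ℕ) (hn : 3 ≤ n) : (1 : ZMod n) ≠ 0 := by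
  have h : ((1 : ℕ) : ZMod n) ≠ 0 := by
    rw [Ne, ZMod.natCast_eq_zero_iff]
    intro h
    have := Nat.le_of_dvd (by norm_num) h
    omega
  simpa using h

lemma two_ne (n : ℕ) (hn : 3 ≤ n) : (2 : ZMod n) ≠ 0 := by
  have h : ((2 : ℕ) : ZMod n) ≠ 0 := by
    rw [Ne, ZMod.natCast_eq_zero_iff]
    intro h
    have := Nat.le_of_dvd (by norm_num) h
    omega
  simpa using h

lemma end_mul {α : Type*} (f g : Function.End α) (p : α) : (f * g) p = f (g p) := rfl

lemma rel_le (n : ℕ) (hn : 3 ≤ n) :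
    conGen (cnRel n) ≤ Con.ker (FreeMonoid.lift (ff n)) := by
  have h1 := one_ne n hn
  have h2 := two_ne n hn
  refine Con.conGen_le.mpr ?_
  intro x y h
  rw [Con.ker_rel]
  rcases h with ⟨a, rfl, rfl⟩ | ⟨a, b, hab, hba, rfl, rfl⟩ | ⟨a, rfl | rfl, rfl⟩ <;>
  · simp only [map_mul, FreeMonoid.lift_eval_of]
    funext p
    simp only [end_mul, ff_apply]
    grind

def phi (n : ℕ) (hn : 3 ≤ n) : Cn n →* Function.End (ZMod n) :=
  Con.lift _ (FreeMonoid.lift (ff n)) (rel_le n hn)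

lemma phi_pr (n : ℕ) (hn : 3 ≤ n) (w : FreeMonoid (ZMod n)) :
    phi n hn (pr n w) = FreeMonoid.lift (ff n) w := rfl

/-- generators -/
def gx (n : ℕ) (a : ZMod n) : Cn n := pr n (FreeMonoid.of a)

lemma phi_gx (n : ℕ) (hn : 3 ≤ n) (a : ZMod n) : phi n hn (gx n a) = ff n a := by
  rw [gx, phi_pr, FreeMonoid.lift_eval_of]

lemma pr_fx (n k : ℕ) : pr n (fx n k) = gx n (k : ZMod n) := rfl

lemma gx_idem (n : ℕ) (a : ZMod n) : gx n a * gx n a = gx n a := by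
  rw [gx, ← map_mul]
  exact (Con.eq _).mpr (ConGen.Rel.of _ _ (Or.inl ⟨a, rfl, rfl⟩))

lemma desc_left (n a b : ℕ) (h : b ≤ a + 1) : desc n (a + 1) b = fx n (a + 1) * desc n a b := by
  apply FreeMonoid.toList.injective
  unfold desc fx
  rw [show a + 1 + 1 - b = (a + 1 - b) + 1 by omega, List.range'_concat]
  simp
  rw [← Nat.cast_add, show b + (a + 1 - b) = a + 1 by omega]
  simp

lemma desc_right (n a b : ℕ) (h : b ≤ a) : desc n a b = desc n a (b + 1) * fx n b := by
  apply FreeMonoid.toList.injective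
  unfold desc fx
  rw [show a + 1 - b = (a + 1 - (b + 1)) + 1 by omega, List.range'_succ]
  simp

lemma desc_empty (n a b : ℕ) (h : a < b) : desc n a b = 1 := by
  unfold desc
  rw [show a + 1 - b = 0 by omega]
  rfl

lemma desc_split (n a b c : ℕ) (h1 : b ≤ c + 1) (h2 : c ≤ a) :
    desc n a b = desc n a (c + 1) * desc n c b := by
  induction a, h2 using Nat.le_induction with
  | base => rw [desc_empty n c (c + 1) (by omega), one_mul]
  | succ a h ih => rw [desc_left n a b (by omega), desc_left n a (c + 1) (by omega), ih, mul_assoc]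

lemma w_eq (n : ℕ) (hn : 3 ≤ n) : fx n n * qw n 0 = desc n n 1 := by
  obtain ⟨m, rfl⟩ : ∃ m, n = m + 1 := ⟨n - 1, by omega⟩
  rw [desc_left _ _ _ (by omega)]
  rfl

lemma cast_inj (n a b : ℕ) (ha : a < n) (hb : b < n) : (a : ZMod n) = b ↔ a = b := by
  rw [ZMod.natCast_eq_natCast_iff', Nat.mod_eq_of_lt ha, Nat.mod_eq_of_lt hb]

lemma phi_desc (n : ℕ) (hn : 3 ≤ n) (m : ℕ) (hm : m < n) (q : ℕ) (hq : q < n) :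
    phi n hn (pr n (desc n m 1)) (q : ZMod n) =
      (((if 1 ≤ q ∧ q ≤ m then q - 1 else q : ℕ)) : ZMod n) := by
  induction m with
  | zero =>
    rw [desc_empty n 0 1 (by omega), map_one, map_one, if_neg (by omega)]
    rfl
  | succ m ih =>
    rw [desc_left _ _ _ (by omega), map_mul, map_mul, pr_fx, phi_gx, end_mul, ih (by omega),
      ff_apply]
    simp only [cast_inj n (if 1 ≤ q ∧ q ≤ m then q - 1 else q) (m + 1)
      (by split_ifs <;> omega) hm]
    by_cases h : q = m + 1
    · subst h
      simp
    · have : ¬ (if 1 ≤ q ∧ q ≤ m then q - 1 else q) = m + 1 := by split_ifs <;> omega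
      rw [if_neg this]
      congr 1
      split_ifs <;> omega

lemma phi_w (n : ℕ) (hn : 3 ≤ n) (q : ℕ) (hq : q < n) (h1 : 1 ≤ q) :
    phi n hn (pr n (desc n n 1)) (q : ZMod n) =
      (((if q = 1 then n - 1 else q - 1 : ℕ)) : ZMod n) := by
  obtain ⟨m, rfl⟩ : ∃ m, n = m + 1 := ⟨n - 1, by omega⟩
  rw [desc_left _ _ _ (by omega), map_mul, map_mul, pr_fx, phi_gx, end_mul,
    phi_desc _ hn _ (by omega) _ hq, if_pos (by omega), ff_apply]
  have h0 : ((m + 1 : ℕ) : ZMod (m + 1)) = ((0 : ℕ) : ZMod (m + 1)) := by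
    rw [Nat.cast_zero, ZMod.natCast_self]
  rw [h0]
  simp only [cast_inj (m + 1) (q - 1) 0 (by omega) (by omega)]
  by_cases h : q = 1
  · subst h
    rw [if_pos rfl, if_pos rfl]
    have : ((m : ZMod (m+1)) + 1) = 0 := by
      have := ZMod.natCast_self (m + 1)
      rwa [Nat.cast_succ] at this
    simp
    linear_combination -this
  · rw [if_neg (by omega), if_neg h]

lemma ne_zero_iff (n : ℕ) (hn : 3 ≤ n) (p : ZMod n) (hp : p ≠ 0) :
    ∃ q : ℕ, 1 ≤ q ∧ q < n ∧ p = (q : ZMod n) := by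
  have : NeZero n := ⟨by omega⟩
  refine ⟨p.val, ?_, ZMod.val_lt p, (ZMod.natCast_zmod_val p).symm⟩
  have := (ZMod.val_ne_zero p).mpr hp
  omega

lemma w_pow (n : ℕ) (hn : 3 ≤ n) (k : ℕ) :
    Set.InjOn (phi n hn (pr n (desc n n 1) ^ k)) {p | p ≠ 0} := by
  induction k with
  | zero =>
    rw [pow_zero, map_one]
    intro a _ b _ h
    exact h
  | succ k ih =>
    rw [pow_succ, map_mul]
    have hm : Set.MapsTo (phi n hn (pr n (desc n n 1))) {p | p ≠ 0} {p | p ≠ 0} := by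
      intro p hp
      obtain ⟨q, h1, h2, rfl⟩ := ne_zero_iff n hn p hp
      rw [phi_w n hn q h2 h1]
      rw [Set.mem_ofPred_eq, ← Nat.cast_zero, Ne, cast_inj _ _ _ (by split_ifs <;> omega) (by omega)]
      split_ifs <;> omega
    have hi : Set.InjOn (phi n hn (pr n (desc n n 1))) {p | p ≠ 0} := by
      intro p hp p' hp' h
      obtain ⟨q, h1, h2, rfl⟩ := ne_zero_iff n hn p hp
      obtain ⟨q', h1', h2', rfl⟩ := ne_zero_iff n hn p' hp'
      rw [phi_w n hn q h2 h1, phi_w n hn q' h2' h1',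
        cast_inj _ _ _ (by split_ifs <;> omega) (by split_ifs <;> omega)] at h
      congr 1
      split_ifs at h <;> omega
    exact ih.comp hi hm

/-- The key fact: a "bad" pair of letters lies in `I_0`. -/
lemma bad_pair (n : ℕ) (hn : 3 ≤ n) (i j : ZMod n) (h1 : j ≠ i) (h2 : j ≠ i + 1) (u v : Cn n)
    (k : ℕ) : u * (gx n j * gx n i) * v ≠ pr n (desc n n 1) ^ k := by
  intro h
  have : NeZero n := ⟨by omega⟩
  have hw := w_pow n hn k
  rw [← h, map_mul, map_mul, map_mul, phi_gx, phi_gx] at hw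
  have e1 := one_ne n hn
  have hinj : Set.InjOn (fun p => ff n j (ff n i (phi n hn v p))) {p | p ≠ 0} := by
    intro a ha b hb hab
    apply hw ha hb
    simp only [end_mul]
    exact congrArg _ hab
  have hmem : ∀ p, ff n j (ff n i p) ∈ ({i, j} : Finset (ZMod n))ᶜ := by
    intro p
    simp only [ff_apply, Finset.mem_compl, Finset.mem_insert, Finset.mem_singleton]
    grind
  have hc := Finset.card_le_card_of_injOn (s := ({0} : Finset (ZMod n))ᶜ)
    (t := ({i, j} : Finset (ZMod n))ᶜ) (fun p => ff n j (ff n i (phi n hn v p)))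
    (fun p _ => hmem _) (by
      intro a ha b hb
      exact hinj (by simpa using ha) (by simpa using hb))
  rw [Finset.card_compl, Finset.card_compl, Finset.card_singleton, Finset.card_pair h1.symm,
    ZMod.card] at hc
  omega

def PP (n : ℕ) (y : Cn n) : Prop :=
  ∃ i m k : ℕ, i < n ∧ 2 ≤ m ∧ m ≤ n + 1 ∧ 1 ≤ k ∧
    y = pr n (desc n i 1) * pr n (desc n n 1) ^ k * pr n (desc n n m)

def NI (n : ℕ) (y : Cn n) : Prop :=
  ∃ (u v : Cn n) (k : ℕ), 1 ≤ k ∧ u * y * v = pr n (desc n n 1) ^ k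

lemma left_first (n : ℕ) (hn : 3 ≤ n) (i j : ZMod n) (y r : Cn n) (hy : y = gx n i * r)
    (h : NI n (gx n j * y)) : j = i ∨ j = i + 1 := by
  obtain ⟨u, v, k, -, h⟩ := h
  by_contra! hc
  refine bad_pair n hn i j hc.1 hc.2 u (r * v) k ?_
  rw [← h, hy]
  simp only [mul_assoc]

lemma right_last (n : ℕ) (hn : 3 ≤ n) (i j : ZMod n) (y r : Cn n) (hy : y = r * gx n i)
    (h : NI n (y * gx n j)) : i = j ∨ i = j + 1 := by
  obtain ⟨u, v, k, -, h⟩ := h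
  by_contra! hc
  refine bad_pair n hn j i hc.1 hc.2 (u * r) v k ?_
  rw [← h, hy]
  simp only [mul_assoc]

lemma absorb_left (n : ℕ) (i : ZMod n) (y r : Cn n) (hy : y = gx n i * r) : gx n i * y = y := by
  rw [hy, ← mul_assoc, gx_idem]

lemma absorb_right (n : ℕ) (i : ZMod n) (y r : Cn n) (hy : y = r * gx n i) : y * gx n i = y := by
  rw [hy, mul_assoc, gx_idem]

lemma step_left (n : ℕ) (hn : 3 ≤ n) (j : ZMod n) (y : Cn n) (hy : PP n y)
    (h : NI n (gx n j * y)) : PP n (gx n j * y) := by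
  obtain ⟨i, m, k, hi, hm, hm', hk, e⟩ := id hy
  obtain ⟨k, rfl⟩ : ∃ l, k = l + 1 := ⟨k - 1, by omega⟩
  have hf : ∃ r, y = gx n i * r := by
    rcases Nat.eq_zero_or_pos i with rfl | hi0
    · refine ⟨pr n (desc n (n - 1) 1) * pr n (desc n n 1) ^ k * pr n (desc n n m), ?_⟩
      rw [e, desc_empty n 0 1 (by omega), map_one, one_mul, pow_succ']
      have h1 : desc n n 1 = fx n n * desc n (n - 1) 1 := by
        obtain ⟨t, rfl⟩ : ∃ t, n = t + 1 := ⟨n - 1, by omega⟩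
        exact desc_left _ _ _ (by omega)
      have h2 : pr n (desc n n 1) = gx n ((0 : ℕ) : ZMod n) * pr n (desc n (n - 1) 1) := by
        rw [h1, map_mul, pr_fx, Nat.cast_zero, ZMod.natCast_self]
      conv_lhs => rw [h2]
      conv_rhs => rw [mul_assoc]
      rw [h2]
      simp only [mul_assoc]
    · obtain ⟨t, rfl⟩ : ∃ t, i = t + 1 := ⟨i - 1, by omega⟩
      refine ⟨pr n (desc n t 1) * pr n (desc n n 1) ^ (k + 1) * pr n (desc n n m), ?_⟩
      rw [e, desc_left _ _ _ (by omega), map_mul, pr_fx]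
      simp only [mul_assoc]
  obtain ⟨r, hr⟩ := hf
  rcases left_first n hn i j y r hr h with rfl | rfl
  · rwa [absorb_left n _ y r hr]
  · have e2 : gx n ((i : ZMod n) + 1) * y =
        pr n (desc n (i + 1) 1) * pr n (desc n n 1) ^ (k + 1) * pr n (desc n n m) := by
      rw [e, desc_left n i 1 (by omega), map_mul (pr n) (fx n (i + 1)), pr_fx, Nat.cast_succ]
      simp only [mul_assoc]
    by_cases hin : i + 1 < n
    · exact ⟨i + 1, m, k + 1, hin, hm, hm', hk, e2⟩
    · have : i + 1 = n := by omega
      refine ⟨0, m, k + 2, by omega, hm, hm', by omega, ?_⟩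
      rw [e2, this, desc_empty n 0 1 (by omega), map_one, one_mul, ← pow_succ']

lemma step_right (n : ℕ) (hn : 3 ≤ n) (j : ZMod n) (y : Cn n) (hy : PP n y)
    (h : NI n (y * gx n j)) : PP n (y * gx n j) := by
  obtain ⟨i, m, k, hi, hm, hm', hk, e⟩ := id hy
  obtain ⟨k, rfl⟩ : ∃ l, k = l + 1 := ⟨k - 1, by omega⟩
  have hf : ∃ r, y = r * gx n m := by
    rcases Nat.eq_or_lt_of_le hm' with rfl | hi0
    · refine ⟨pr n (desc n i 1) * (pr n (desc n n 1) ^ k * pr n (desc n n 2)), ?_⟩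
      rw [e, desc_empty n n (n + 1) (by omega), map_one, mul_one, pow_succ]
      have h2 : pr n (desc n n 1) = pr n (desc n n 2) * gx n ((n + 1 : ℕ) : ZMod n) := by
        rw [desc_right n n 1 (by omega), map_mul, pr_fx]
        simp
      rw [mul_assoc, mul_assoc (pr n (desc n n 1) ^ k), ← h2]
    · refine ⟨pr n (desc n i 1) * pr n (desc n n 1) ^ (k + 1) * pr n (desc n n (m + 1)), ?_⟩
      rw [e, desc_right n n m (by omega), map_mul, pr_fx]
      simp only [mul_assoc]
  obtain ⟨r, hr⟩ := hf
  rcases right_last n hn m j y r hr h with rfl | hj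
  · rwa [absorb_right n _ y r hr]
  · obtain ⟨t, rfl⟩ : ∃ t, m = t + 1 := ⟨m - 1, by omega⟩
    have hj' : j = (t : ZMod n) := by
      rw [Nat.cast_succ] at hj
      exact (add_right_cancel hj).symm
    subst hj'
    have e2 : y * gx n (t : ZMod n) =
        pr n (desc n i 1) * pr n (desc n n 1) ^ (k + 1) * pr n (desc n n t) := by
      rw [e, desc_right n n t (by omega), map_mul (pr n) _ (fx n t), pr_fx]
      simp only [mul_assoc]
    by_cases hin : 2 ≤ t
    · exact ⟨i, t, k + 1, hi, hin, by omega, hk, e2⟩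
    · have : t = 1 := by omega
      refine ⟨i, n + 1, k + 2, hi, by omega, by omega, by omega, ?_⟩
      rw [e2, this, desc_empty n n (n + 1) (by omega), map_one, mul_one, mul_assoc, ← pow_succ]

lemma NI_left (n : ℕ) (x y : Cn n) (h : NI n (x * y)) : NI n y := by
  obtain ⟨u, v, k, hk, h⟩ := h
  exact ⟨u * x, v, k, hk, by rw [← h]; simp only [mul_assoc]⟩

lemma NI_right (n : ℕ) (x y : Cn n) (h : NI n (y * x)) : NI n y := by
  obtain ⟨u, v, k, hk, h⟩ := h
  exact ⟨u, x * v, k, hk, by rw [← h]; simp only [mul_assoc]⟩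

lemma all_left (n : ℕ) (hn : 3 ≤ n) (u : FreeMonoid (ZMod n)) (y : Cn n)
    (hy : NI n y → PP n y) : NI n (pr n u * y) → PP n (pr n u * y) := by
  induction u using FreeMonoid.inductionOn' with
  | one => simpa using hy
  | of_mul a u ih =>
    rw [map_mul, mul_assoc]
    intro h
    exact step_left n hn a _ (ih (NI_left n _ _ h)) h

lemma all_right (n : ℕ) (hn : 3 ≤ n) (u : FreeMonoid (ZMod n)) (y : Cn n)
    (hy : NI n y → PP n y) : NI n (y * pr n u) → PP n (y * pr n u) := by
  induction u using FreeMonoid.inductionOn' generalizing y with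
  | one => simpa using hy
  | of_mul a u ih =>
    rw [map_mul, ← mul_assoc]
    exact ih _ (fun h => step_right n hn a _ (hy (NI_right n _ _ h)) h)

/-- Lemma 3.20 (lemI_{-1}): `I_{-1} = M̃_0 ∪ I_0`. -/
theorem stmt12 (n : ℕ) (hn : 3 ≤ n) (u v : Cn n) :
    u * pr n (fx n n * qw n 0) * v ∈ Iset n 0 ∨
    ∃ (a b : FreeMonoid (ZMod n)) (k : ℕ), 1 ≤ k ∧
      (∃ p : FreeMonoid (ZMod n), p * a = desc n (n - 1) 1) ∧
      (∃ p : FreeMonoid (ZMod n), b * p = fx n n * desc n (n - 1) 2) ∧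
      u * pr n (fx n n * qw n 0) * v =
        pr n a * (pr n (fx n n * qw n 0)) ^ k * pr n b := by
  unfold Iset
  rw [w_eq n hn]
  obtain ⟨u, rfl⟩ : ∃ u', u = pr n u' := (Con.mk'_surjective u).imp fun _ h => h.symm
  obtain ⟨v, rfl⟩ : ∃ v', v = pr n v' := (Con.mk'_surjective v).imp fun _ h => h.symm
  by_cases h : NI n (pr n u * pr n (desc n n 1) * pr n v)
  · right
    obtain ⟨i, m, k, hi, hm, hm', hk, e⟩ := all_right n hn v _ (all_left n hn u (pr n (desc n n 1))
      (fun _ => ⟨0, n + 1, 1, by omega, by omega, by omega, le_refl _, by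
        rw [desc_empty n 0 1 (by omega), desc_empty n n (n + 1) (by omega)]; simp⟩)) h
    refine ⟨desc n i 1, desc n n m, k, hk,
      ⟨desc n (n - 1) (i + 1), (desc_split n (n - 1) 1 i (by omega) (by omega)).symm⟩,
      ⟨desc n (m - 1) 2, ?_⟩, e⟩
    have h1 : fx n n * desc n (n - 1) 2 = desc n n 2 := by
      obtain ⟨t, rfl⟩ : ∃ t, n = t + 1 := ⟨n - 1, by omega⟩
      exact (desc_left _ _ _ (by omega)).symm
    rw [h1, desc_split n n 2 (m - 1) (by omega) (by omega), show m - 1 + 1 = m by omega]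
  · left
    exact h

end HK
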